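/- A bounded linear map D : 𝒜⋊𝔄 → (𝒜⋊𝔄)^(1) is a cyclic derivation if and only if there exist cyclic derivations D¹_𝒜 : 𝒜 → 𝒜^(1) and D²_𝔄 : 𝔄 → 𝔄^(1), a derivation D¹_𝔄 : 𝔄 → 𝒜^(1), and a bounded linear map D²_𝒜 : 𝒜 → 𝔄^(1) such that for all a, b ∈ 𝒜 and β ∈ 𝔄: (i) D((a, β)) = (D¹_𝒜(a) + D¹_𝔄(β), D²_𝒜(a) + D²_𝔄(β)); (ii) D¹_𝒜(β·a) = D¹_𝔄(β)∘a + β▴D¹_𝒜(a) and D¹_𝒜(a·β) = a△D¹_𝔄(β) + D¹_𝒜(a)∙β; (iii) D²_𝒜(β·a) = D¹_𝔄(β)∙a + β△D²_𝒜(a) and D²_𝒜(a·β) = a▴D¹_𝔄(β) + D²_𝒜(a)∘β; (iv) D²_𝒜(ab) = D¹_𝒜(a)∙b + a▴D¹_𝒜(b); (v) (D²_𝒜)* ∘ Φ + D¹_𝔄 = 0, where Φ : 𝔄 → 𝔄^(2) is the canonical embedding and (D²_𝒜)* : 𝔄^(2) → 𝒜^(1) is the adjoint of D²_𝒜. -/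

import Mathlib

noncomputable section

open ContinuousLinearMap

/-- `𝒜` is a Banach `𝔄`-bimodule with compatible actions: the left action `l` and right
action `r` are continuous bilinear maps satisfying the module axioms and the
compatibility conditions `β·(ab) = (β·a)b`, `(ab)·β = a(b·β)`, `a(β·b) = (a·β)b`. -/
structure BiAction (A B : Type) [NonUnitalNormedRing A] [NormedSpace ℂ A]
    [IsScalarTower ℂ A A] [SMulCommClass ℂ A A]
    [NonUnitalNormedRing B] [NormedSpace ℂ B] [IsScalarTower ℂ B B] [SMulCommClass ℂ B B] :
    Type where
  l : B →L[ℂ] A →L[ℂ] A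
  r : A →L[ℂ] B →L[ℂ] A
  l_mul : ∀ (β γ : B) (a : A), l (β * γ) a = l β (l γ a)
  r_mul : ∀ (a : A) (β γ : B), r a (β * γ) = r (r a β) γ
  lr_assoc : ∀ (β : B) (a : A) (γ : B), r (l β a) γ = l β (r a γ)
  compat_l : ∀ (β : B) (a b : A), l β (a * b) = l β a * b
  compat_r : ∀ (a b : A) (β : B), r (a * b) β = a * r b β
  compat_m : ∀ (a : A) (β : B) (b : A), a * l β b = r a β * b

variable {A B : Type} [NonUnitalNormedRing A] [NormedSpace ℂ A]
    [IsScalarTower ℂ A A] [SMulCommClass ℂ A A]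
    [NonUnitalNormedRing B] [NormedSpace ℂ B] [IsScalarTower ℂ B B] [SMulCommClass ℂ B B]

/-- The multiplication of the amalgamated duplication `𝒜 ⋊ 𝔄`:
`(a, β)(b, γ) = (ab + a·γ + β·b, βγ)`. -/
def dupMul (σ : BiAction A B) (x y : A × B) : A × B :=
  (x.1 * y.1 + σ.r x.1 y.2 + σ.l x.2 y.1, x.2 * y.2)


variable [CompleteSpace A] [CompleteSpace B]

/-- `x ∘ a` on `𝒜^(1)`: `⟨x ∘ a, b⟩ = ⟨x, ab⟩`. -/
def circA (σ : BiAction A B) (x : A →L[ℂ] ℂ) (a : A) : A →L[ℂ] ℂ :=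
  x.comp (ContinuousLinearMap.mul ℂ A a)

/-- `a △ x` on `𝒜^(1)`: `⟨a △ x, b⟩ = ⟨x, ba⟩`. -/
def triA (σ : BiAction A B) (a : A) (x : A →L[ℂ] ℂ) : A →L[ℂ] ℂ :=
  x.comp ((ContinuousLinearMap.mul ℂ A).flip a)

/-- `x ∙ β : 𝒜^(1) × 𝔄 → 𝒜^(1)`: `⟨x ∙ β, b⟩ = ⟨x, β·b⟩`. -/
def bulAB (σ : BiAction A B) (x : A →L[ℂ] ℂ) (β : B) : A →L[ℂ] ℂ :=
  x.comp (σ.l β)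

/-- `β ▴ x : 𝔄 × 𝒜^(1) → 𝒜^(1)`: `⟨β ▴ x, b⟩ = ⟨x, b·β⟩`. -/
def blaBA (σ : BiAction A B) (β : B) (x : A →L[ℂ] ℂ) : A →L[ℂ] ℂ :=
  x.comp (σ.r.flip β)

/-- `x ∙ a : 𝒜^(1) × 𝒜 → 𝔄^(1)`: `⟨x ∙ a, γ⟩ = ⟨x, a·γ⟩`. -/
def bulAA (σ : BiAction A B) (x : A →L[ℂ] ℂ) (a : A) : B →L[ℂ] ℂ :=
  x.comp (σ.r a)

/-- `a ▴ x : 𝒜 × 𝒜^(1) → 𝔄^(1)`: `⟨a ▴ x, γ⟩ = ⟨x, γ·a⟩`. -/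
def blaAA (σ : BiAction A B) (a : A) (x : A →L[ℂ] ℂ) : B →L[ℂ] ℂ :=
  x.comp (σ.l.flip a)

/-- `y ∘ β` on `𝔄^(1)`: `⟨y ∘ β, γ⟩ = ⟨y, βγ⟩`. -/
def circB (σ : BiAction A B) (y : B →L[ℂ] ℂ) (β : B) : B →L[ℂ] ℂ :=
  y.comp (ContinuousLinearMap.mul ℂ B β)

/-- `β △ y` on `𝔄^(1)`: `⟨β △ y, γ⟩ = ⟨y, γβ⟩`. -/
def triB (σ : BiAction A B) (β : B) (y : B →L[ℂ] ℂ) : B →L[ℂ] ℂ :=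
  y.comp ((ContinuousLinearMap.mul ℂ B).flip β)

/-- The left action of `𝒜 ⋊ 𝔄` on `(𝒜 ⋊ 𝔄)^(1) ≅ 𝒜^(1) × 𝔄^(1)`:
`(a, β)·(x, y) = (a △ x + β ▴ x, a ▴ x + β △ y)`. -/
def leftAct1 (σ : BiAction A B) (s : A × B) (z : (A →L[ℂ] ℂ) × (B →L[ℂ] ℂ)) :
    (A →L[ℂ] ℂ) × (B →L[ℂ] ℂ) :=
  (triA σ s.1 z.1 + blaBA σ s.2 z.1, blaAA σ s.1 z.1 + triB σ s.2 z.2)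

/-- The right action of `𝒜 ⋊ 𝔄` on `(𝒜 ⋊ 𝔄)^(1) ≅ 𝒜^(1) × 𝔄^(1)`:
`(x, y)·(a, β) = (x ∘ a + x ∙ β, x ∙ a + y ∘ β)`. -/
def rightAct1 (σ : BiAction A B) (z : (A →L[ℂ] ℂ) × (B →L[ℂ] ℂ)) (t : A × B) :
    (A →L[ℂ] ℂ) × (B →L[ℂ] ℂ) :=
  (circA σ z.1 t.1 + bulAB σ z.1 t.2, bulAA σ z.1 t.1 + circB σ z.2 t.2)

/-- `D : 𝒜 ⋊ 𝔄 → (𝒜 ⋊ 𝔄)^(1)` is a derivation. -/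
def IsDeriv1 (σ : BiAction A B) (D : (A × B) →L[ℂ] ((A →L[ℂ] ℂ) × (B →L[ℂ] ℂ))) : Prop :=
  ∀ s t : A × B, D (dupMul σ s t) = leftAct1 σ s (D t) + rightAct1 σ (D s) t

/-- `D : 𝒜 ⋊ 𝔄 → (𝒜 ⋊ 𝔄)^(1)` is cyclic: `⟨D(s), t⟩ + ⟨D(t), s⟩ = 0`. -/
def IsCyclic1 (σ : BiAction A B) (D : (A × B) →L[ℂ] ((A →L[ℂ] ℂ) × (B →L[ℂ] ℂ))) : Prop :=
  ∀ s t : A × B, ((D s).1 t.1 + (D s).2 t.2) + ((D t).1 s.1 + (D t).2 s.2) = 0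

/-- A bounded linear map `D : 𝒜 ⋊ 𝔄 → (𝒜 ⋊ 𝔄)^(1)` is a cyclic derivation
if and only if there are cyclic derivations `D¹_𝒜 : 𝒜 → 𝒜^(1)`, `D²_𝔄 : 𝔄 → 𝔄^(1)`, a
derivation `D¹_𝔄 : 𝔄 → 𝒜^(1)` and a bounded linear map `D²_𝒜 : 𝒜 → 𝔄^(1)` satisfying
(i)–(v). -/
theorem isCyclicDerivation_dup_iff (σ : BiAction A B)
    (D : (A × B) →L[ℂ] ((A →L[ℂ] ℂ) × (B →L[ℂ] ℂ))) :
    (IsDeriv1 σ D ∧ IsCyclic1 σ D) ↔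
      ∃ (D1A : A →L[ℂ] (A →L[ℂ] ℂ)) (D1B : B →L[ℂ] (A →L[ℂ] ℂ))
        (D2B : B →L[ℂ] (B →L[ℂ] ℂ)) (D2A : A →L[ℂ] (B →L[ℂ] ℂ)),
        -- `D¹_𝒜` is a cyclic derivation
        (∀ a b : A, D1A (a * b) = triA σ a (D1A b) + circA σ (D1A a) b) ∧
        (∀ a b : A, D1A a b + D1A b a = 0) ∧
        -- `D²_𝔄` is a cyclic derivation
        (∀ β γ : B, D2B (β * γ) = triB σ β (D2B γ) + circB σ (D2B β) γ) ∧
        (∀ β γ : B, D2B β γ + D2B γ β = 0) ∧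
        -- `D¹_𝔄` is a derivation
        (∀ β γ : B, D1B (β * γ) = blaBA σ β (D1B γ) + bulAB σ (D1B β) γ) ∧
        -- (i)
        (∀ (a : A) (β : B), D (a, β) = (D1A a + D1B β, D2A a + D2B β)) ∧
        -- (ii)
        (∀ (β : B) (a : A), D1A (σ.l β a) = circA σ (D1B β) a + blaBA σ β (D1A a)) ∧
        (∀ (a : A) (β : B), D1A (σ.r a β) = triA σ a (D1B β) + bulAB σ (D1A a) β) ∧
        -- (iii)
        (∀ (β : B) (a : A), D2A (σ.l β a) = bulAA σ (D1B β) a + triB σ β (D2A a)) ∧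
        (∀ (a : A) (β : B), D2A (σ.r a β) = blaAA σ a (D1B β) + circB σ (D2A a) β) ∧
        -- (iv)
        (∀ a b : A, D2A (a * b) = bulAA σ (D1A a) b + blaAA σ a (D1A b)) ∧
        -- (v)  `(D²_𝒜)^* ∘ Φ + D¹_𝔄 = 0`
        (∀ (β : B) (a : A), D2A a β + D1B β a = 0) := by
  constructor
  · rintro ⟨hD, hC⟩
    have hAA (a b : A) := hD (a, 0) (b, 0)
    have hAB (a : A) (β : B) := hD (a, 0) (0, β)
    have hBA (β : B) (a : A) := hD (0, β) (a, 0)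
    have hBB (β γ : B) := hD (0, β) (0, γ)
    simp only [dupMul, leftAct1, rightAct1, triA, circA, bulAB, blaBA, bulAA, blaAA, circB, triB,
      map_zero, zero_apply, mul_zero, zero_mul, add_zero, zero_add, comp_zero, Prod.mk_add_mk,
      Prod.ext_iff] at hAA hAB hBA hBB
    refine ⟨(fst ℂ _ _).comp (D.comp (inl ℂ A B)), (fst ℂ _ _).comp (D.comp (inr ℂ A B)),
      (snd ℂ _ _).comp (D.comp (inr ℂ A B)), (snd ℂ _ _).comp (D.comp (inl ℂ A B)),
      fun a b => (hAA a b).1, fun a b => ?_, fun β γ => (hBB β γ).2, fun β γ => ?_,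
      fun β γ => (hBB β γ).1, fun a β => ?_, fun β a => ?_, fun a β => (hAB a β).1,
      fun β a => ?_, fun a β => (hAB a β).2, fun a b => ?_, fun β a => ?_⟩
    · simpa using hC (a, 0) (b, 0)
    · simpa using hC (0, β) (0, γ)
    · have h : ((a, β) : A × B) = (a, 0) + (0, β) := by simp
      rw [h, map_add]
      rfl
    · exact (hBA β a).1.trans (add_comm _ _)
    · exact (hBA β a).2.trans (add_comm _ _)
    · exact (hAA a b).2.trans (add_comm _ _)
    · simpa using hC (a, 0) (0, β)
  · rintro ⟨D1A, D1B, D2B, D2A, hA, hAc, hB, hBc, hBA, hD, hl₁, hr₁, hl₂, hr₂, hm, hc⟩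
    refine ⟨?_, ?_⟩
    · rintro ⟨a, β⟩ ⟨b, γ⟩
      simp only [dupMul, leftAct1, rightAct1, hD, map_add, hA, hB, hBA, hl₁, hr₁, hl₂, hr₂, hm]
      ext x <;>
        simp only [triA, circA, bulAB, blaBA, bulAA, blaAA, circB, triB, Prod.mk_add_mk, comp_apply,
          add_apply] <;>
        abel
    · rintro ⟨a, β⟩ ⟨b, γ⟩
      simp only [hD, add_apply]
      linear_combination hAc a b + hBc β γ + hc γ a + hc β b

end
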